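/- Let d ≥ 2, let μ be the Haar probability measure on U(d), let ν be any Borel probability measure on U(d), let O be a d×d Hermitian matrix and ρ a pure-state density matrix (positive semidefinite, Tr[ρ] = 1, ρ² = ρ). Define the second-order expressivity operator A₂(ρ⊗ρ) := ∫ (V ⊗ V)(ρ ⊗ ρ)(V ⊗ V)† dμ(V) − ∫ (U ⊗ U)(ρ ⊗ ρ)(U ⊗ U)† dν(U), where ⊗ is the Kronecker product. Then the second moment of the cost satisfies E_ν[C²] := ∫ (Tr[O U ρ U†])² dν(U) = ((Tr[O])² + Tr[O²])/(d² − 1) · (1 − 1/d) − Tr[(O ⊗ O) · A₂(ρ⊗ρ)]. -/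

import Mathlib

open MeasureTheory Matrix
open scoped Kronecker ComplexOrder

noncomputable section

attribute [local instance] Matrix.frobeniusNormedAddCommGroup Matrix.frobeniusNormedSpace

local instance {n m : Type*} [Fintype n] [Fintype m] : MeasurableSpace (Matrix n m ℂ) :=
  borel _

local instance {n m : Type*} [Fintype n] [Fintype m] : BorelSpace (Matrix n m ℂ) := ⟨rfl⟩

/-- The Frobenius (Hilbert–Schmidt) norm `‖M‖₂ = √Tr[M† M]`. -/
def frobNorm {n : Type*} [Fintype n] (M : Matrix n n ℂ) : ℝ :=
  Real.sqrt (Matrix.trace (star M * M)).re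

/-- Conjugated state. -/
def conjState {d : ℕ} (ρ : Matrix (Fin d) (Fin d) ℂ) (U : Matrix.unitaryGroup (Fin d) ℂ) :
    Matrix (Fin d) (Fin d) ℂ := U.1 * ρ * star U.1

lemma compactSpace_unitary (d : ℕ) : CompactSpace (Matrix.unitaryGroup (Fin d) ℂ) := by
  apply isCompact_iff_compactSpace.mp
  apply Metric.isCompact_of_isClosed_isBounded
  · have : ((Matrix.unitaryGroup (Fin d) ℂ : Submonoid _) : Set (Matrix (Fin d) (Fin d) ℂ))
        = {A | star A * A = 1} := by
      ext A; exact Matrix.mem_unitaryGroup_iff'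
    rw [this]
    exact isClosed_eq (by fun_prop) (by fun_prop)
  · refine (Metric.isBounded_iff_subset_closedBall 0).2 ⟨(∑ _i : Fin d, ∑ _j : Fin d, (1 : ℝ) ^ (2 : ℝ)) ^ (1 / 2 : ℝ), fun A hA => ?_⟩
    rw [mem_closedBall_zero_iff, Matrix.frobenius_norm_def]
    gcongr with i _ j _
    exact entry_norm_bound_of_unitary hA i j

lemma integrable_unitary {d : ℕ} {E : Type*} [NormedAddCommGroup E] [SecondCountableTopology E]
    (ν : Measure (Matrix.unitaryGroup (Fin d) ℂ)) [IsProbabilityMeasure ν]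
    (f : Matrix.unitaryGroup (Fin d) ℂ → E) (hf : Continuous f) : Integrable f ν := by
  have := compactSpace_unitary d
  have := hf.integrable_of_hasCompactSupport (μ := ν) (HasCompactSupport.of_compactSpace f)
  exact this

lemma continuous_conjState {d : ℕ} (ρ : Matrix (Fin d) (Fin d) ℂ) : Continuous (conjState ρ) := by
  unfold conjState
  fun_prop

lemma conjState_mul {d : ℕ} (ρ : Matrix (Fin d) (Fin d) ℂ) (W U : Matrix.unitaryGroup (Fin d) ℂ) :
    conjState ρ (W * U) = W.1 * conjState ρ U * star W.1 := by
  simp [conjState, Matrix.mul_assoc]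

lemma invariance {d : ℕ} (μ : Measure (Matrix.unitaryGroup (Fin d) ℂ))
    [μ.IsHaarMeasure] (ρ : Matrix (Fin d) (Fin d) ℂ) (W : Matrix (Fin d) (Fin d) ℂ)
    (hW : W * star W = 1) (f : Matrix (Fin d) (Fin d) ℂ → ℂ) :
    ∫ U, f (W * conjState ρ U * star W) ∂μ = ∫ U, f (conjState ρ U) ∂μ := by
  have := integral_mul_left_eq_self (μ := μ) (fun U => f (conjState ρ U))
    ⟨W, Matrix.mem_unitaryGroup_iff.2 hW⟩
  simpa only [conjState_mul] using this

lemma trace_part {d : ℕ} (ν : Measure (Matrix.unitaryGroup (Fin d) ℂ)) [IsProbabilityMeasure ν]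
    (O ρ : Matrix (Fin d) (Fin d) ℂ) :
    ((O ⊗ₖ O) * ∫ U : Matrix.unitaryGroup (Fin d) ℂ,
                    (U.1 ⊗ₖ U.1) * (ρ ⊗ₖ ρ) * star (U.1 ⊗ₖ U.1) ∂ν).trace
     = ∫ U : Matrix.unitaryGroup (Fin d) ℂ, ((O * (U.1 * ρ * star U.1)).trace) ^ 2 ∂ν := by
  let L : Matrix (Fin d × Fin d) (Fin d × Fin d) ℂ →ₗ[ℂ] ℂ :=
    (Matrix.traceLinearMap _ ℂ ℂ) ∘ₗ LinearMap.mulLeft ℂ (O ⊗ₖ O)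
  have h := (LinearMap.toContinuousLinearMap L).integral_comp_comm (μ := ν)
    (φ := fun U : Matrix.unitaryGroup (Fin d) ℂ =>
      (U.1 ⊗ₖ U.1) * (ρ ⊗ₖ ρ) * star (U.1 ⊗ₖ U.1)) (by
      apply integrable_unitary
      have : Continuous fun U : Matrix.unitaryGroup (Fin d) ℂ => U.1 ⊗ₖ U.1 := by
        refine continuous_matrix fun i j => ?_
        simp only [Matrix.kroneckerMap_apply]
        have h : Continuous fun U : Matrix.unitaryGroup (Fin d) ℂ => U.1 := continuous_subtype_val
        exact (h.matrix_elem _ _).mul (h.matrix_elem _ _)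
      exact (this.mul continuous_const).mul this.star)
  change _ = L _ at h
  change L _ = _
  rw [← h]
  congr 1
  ext U
  change (O ⊗ₖ O * _).trace = _
  rw [Matrix.star_eq_conjTranspose, Matrix.conjTranspose_kronecker, ← Matrix.mul_kronecker_mul,
    ← Matrix.mul_kronecker_mul, ← Matrix.mul_kronecker_mul, Matrix.trace_kronecker, sq]
  rfl

lemma minor_zero {d : ℕ} (R : Matrix (Fin d) (Fin d) ℂ) (hR : R.PosSemidef)
    (h1 : R.trace = 1) (h2 : R * R = R) (i j : Fin d) : R i j * R j i = R i i * R j j := by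
  have hnn : ∀ p : Fin d × Fin d, 0 ≤ R p.1 p.1 * R p.2 p.2 - R p.1 p.2 * R p.2 p.1 := by
    rintro ⟨i, j⟩
    have := (hR.submatrix ![i, j]).det_nonneg
    rw [Matrix.det_fin_two] at this
    simpa using this
  have hs : ∑ p : Fin d × Fin d, (R p.1 p.1 * R p.2 p.2 - R p.1 p.2 * R p.2 p.1) = 0 := by
    rw [Fintype.sum_prod_type]
    simp only [Finset.sum_sub_distrib, ← Finset.mul_sum, ← Matrix.mul_apply, h2, ← Finset.sum_mul]
    have : ∑ i, R i i = 1 := h1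
    rw [this]
    simp
  have := (Finset.sum_eq_zero_iff_of_nonneg (fun p _ => hnn p)).1 hs (i, j) (Finset.mem_univ _)
  exact (sub_eq_zero.1 this).symm


section moments
set_option linter.unusedSectionVars false

variable {d : ℕ} (μ : Measure (Matrix.unitaryGroup (Fin d) ℂ)) [μ.IsHaarMeasure]
  [IsProbabilityMeasure μ] (ρ : Matrix (Fin d) (Fin d) ℂ)

lemma integrable_prod (i j k l : Fin d) :
    Integrable (fun U => conjState ρ U i j * conjState ρ U k l) μ := by
  apply integrable_unitary
  have h := continuous_conjState ρ
  exact (h.matrix_elem _ _).mul (h.matrix_elem _ _)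

lemma conjState_minor (hρ : ρ.PosSemidef)
    (hρ1 : ρ.trace = 1) (hρ2 : ρ * ρ = ρ) (U : Matrix.unitaryGroup (Fin d) ℂ) (i j : Fin d) :
    conjState ρ U i j * conjState ρ U j i = conjState ρ U i i * conjState ρ U j j := by
  have hU : star U.1 * U.1 = 1 := Matrix.mem_unitaryGroup_iff'.1 U.2
  apply minor_zero
  · exact hρ.mul_mul_conjTranspose_same _
  · rw [conjState, Matrix.trace_mul_comm, ← Matrix.mul_assoc, hU, Matrix.one_mul, hρ1]
  · calc U.1 * ρ * star U.1 * (U.1 * ρ * star U.1)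
        = U.1 * (ρ * (star U.1 * U.1) * ρ) * star U.1 := by simp only [Matrix.mul_assoc]
      _ = _ := by rw [hU, Matrix.mul_one, hρ2, conjState]

lemma conjState_trace (hρ1 : ρ.trace = 1) (U : Matrix.unitaryGroup (Fin d) ℂ) :
    ∑ i, conjState ρ U i i = 1 := by
  have hU : star U.1 * U.1 = 1 := Matrix.mem_unitaryGroup_iff'.1 U.2
  change (conjState ρ U).trace = 1
  rw [conjState, Matrix.trace_mul_comm, ← Matrix.mul_assoc, hU, Matrix.one_mul, hρ1]

lemma phase_zero (i j : Fin d) (hij : i ≠ j) :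
    ∫ U, conjState ρ U i j * conjState ρ U i j ∂μ = 0 := by
  let v : Fin d → ℂ := fun k => if k = i then Complex.I else 1
  have hs : star (Matrix.diagonal v) = Matrix.diagonal (star v) := Matrix.diagonal_conjTranspose v
  have hW : Matrix.diagonal v * star (Matrix.diagonal v) = 1 := by
    rw [hs, Matrix.diagonal_mul_diagonal, ← Matrix.diagonal_one]
    congr 1
    ext k
    by_cases h : k = i <;> simp [v, h]
  have h := invariance μ ρ _ hW (fun R => R i j * R i j)
  rw [hs] at h
  have e : ∀ R : Matrix (Fin d) (Fin d) ℂ,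
      (Matrix.diagonal v * R * Matrix.diagonal (star v)) i j = Complex.I * R i j := by
    intro R
    rw [Matrix.mul_diagonal, Matrix.diagonal_mul]
    simp [v, hij.symm]
  simp only [e] at h
  have e2 : ∀ x : ℂ, Complex.I * x * (Complex.I * x) = - (x * x) := by
    intro x; linear_combination (x * x) * Complex.I_mul_I
  simp only [e2, integral_neg] at h
  linear_combination -(1/2) * h

lemma diag_eq (i j : Fin d) :
    ∫ U, conjState ρ U i i * conjState ρ U i i ∂μ
      = ∫ U, conjState ρ U j j * conjState ρ U j j ∂μ := by
  have hs : star (Matrix.swap ℂ i j) = Matrix.swap ℂ i j := by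
    simp [Matrix.star_eq_conjTranspose]
  have h := invariance μ ρ (Matrix.swap ℂ i j) (by rw [hs]; simp [Matrix.swap_mul_self])
    (fun R => R j j * R j j)
  rw [hs] at h
  simpa using h

/-- Square root of the swap of two coordinates, `1 + ((I - 1) / 2) (e_i - e_j) (e_i - e_j)ᵀ`. -/
def rootSwap (i j : Fin d) : Matrix (Fin d) (Fin d) ℂ :=
  1 + ((Complex.I - 1) / 2) • Matrix.vecMulVec (Pi.single i 1 - Pi.single j 1)
    (Pi.single i 1 - Pi.single j 1)

lemma star_rootSwap (i j : Fin d) : star (rootSwap i j) =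
    1 + ((-Complex.I - 1) / 2) • Matrix.vecMulVec (Pi.single i 1 - Pi.single j 1)
    (Pi.single i 1 - Pi.single j 1) := by
  ext k l
  simp only [rootSwap, Matrix.star_apply, Matrix.add_apply, Matrix.smul_apply, Matrix.vecMulVec_apply,
    Matrix.one_apply, Pi.sub_apply, Pi.single_apply, smul_eq_mul]
  have : (k = l) = (l = k) := propext eq_comm
  simp only [this]
  split_ifs <;> simp

lemma rootSwap_unitary (i j : Fin d) (hij : i ≠ j) : rootSwap i j * star (rootSwap i j) = 1 := by
  rw [star_rootSwap, rootSwap]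
  set w : Fin d → ℂ := Pi.single i 1 - Pi.single j 1 with hw
  have hww : w ⬝ᵥ w = 2 := by
    simp [hw, hij, hij.symm]; norm_num
  simp only [Matrix.add_mul, Matrix.mul_add, Matrix.one_mul, Matrix.mul_one, Matrix.smul_mul,
    Matrix.mul_smul, Matrix.vecMulVec_mul_vecMulVec, hww]
  ext k l
  simp [Matrix.vecMulVec_apply]
  ring_nf
  simp

lemma rootSwap_conj (i j : Fin d) (R : Matrix (Fin d) (Fin d) ℂ) (hij : i ≠ j) :
    (rootSwap i j * R * star (rootSwap i j)) i i * (rootSwap i j * R * star (rootSwap i j)) j j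
      = ((R i i + R j j) ^ 2 + (R i j - R j i) ^ 2) / 4 := by
  rw [star_rootSwap, rootSwap]
  simp only [Matrix.add_mul, Matrix.mul_add, Matrix.one_mul, Matrix.mul_one, Matrix.smul_mul,
    Matrix.mul_smul, Matrix.vecMulVec_mul, Matrix.mul_vecMulVec]
  simp [Matrix.vecMulVec_apply, hij, hij.symm, Matrix.sub_vecMul, Matrix.mulVec_sub]
  ring_nf
  simp
  ring

lemma offdiag (hρ : ρ.PosSemidef)
    (hρ1 : ρ.trace = 1) (hρ2 : ρ * ρ = ρ) (i j : Fin d) (hij : i ≠ j) :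
    2 * ∫ U, conjState ρ U i i * conjState ρ U j j ∂μ
      = ∫ U, conjState ρ U i i * conjState ρ U i i ∂μ := by
  have h := invariance μ ρ _ (rootSwap_unitary i j hij) (fun R => R i i * R j j)
  simp only [rootSwap_conj i j _ hij] at h
  have e : ∀ U, ((conjState ρ U i i + conjState ρ U j j) ^ 2
      + (conjState ρ U i j - conjState ρ U j i) ^ 2) / 4
      = (1 / 4 : ℂ) * ((conjState ρ U i i * conjState ρ U i i + conjState ρ U j j * conjState ρ U j j)
        + (conjState ρ U i j * conjState ρ U i j + conjState ρ U j i * conjState ρ U j i)) := by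
    intro U
    linear_combination (-1/2) * conjState_minor ρ hρ hρ1 hρ2 U i j
  simp only [e] at h
  have I := integrable_prod μ ρ
  have I2 : ∀ i j k l i' j' k' l' : Fin d, Integrable (fun U => conjState ρ U i j * conjState ρ U k l
      + conjState ρ U i' j' * conjState ρ U k' l') μ :=
    fun i j k l i' j' k' l' => (I i j k l).add (I i' j' k' l')
  rw [integral_const_mul, integral_add (I2 _ _ _ _ _ _ _ _) (I2 _ _ _ _ _ _ _ _),
    integral_add (I _ _ _ _) (I _ _ _ _), integral_add (I _ _ _ _) (I _ _ _ _),
    phase_zero μ ρ i j hij, phase_zero μ ρ j i hij.symm, diag_eq μ ρ j i] at h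
  linear_combination -2 * h

lemma moment_value (hρ : ρ.PosSemidef)
    (hρ1 : ρ.trace = 1) (hρ2 : ρ * ρ = ρ) (i j : Fin d) :
    ∫ U, conjState ρ U i i * conjState ρ U j j ∂μ
      = (1 + if i = j then 1 else 0) / ((d : ℂ) * (d + 1)) := by
  have I := integrable_prod μ ρ
  set a := ∫ U, conjState ρ U i i * conjState ρ U i i ∂μ with ha
  have hG : ∀ k l, ∫ U, conjState ρ U k k * conjState ρ U l l ∂μ
      = a / 2 * (1 + if k = l then 1 else 0) := by
    intro k l
    by_cases h : k = l
    · subst h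
      rw [diag_eq μ ρ k i, if_pos rfl]; ring
    · have := offdiag μ ρ hρ hρ1 hρ2 k l h
      rw [diag_eq μ ρ k i] at this
      rw [if_neg h, ha, ← this]; ring
  have hsum : ∑ k, ∑ l, ∫ U, conjState ρ U k k * conjState ρ U l l ∂μ = 1 := by
    have : ∀ k, ∑ l, ∫ U, conjState ρ U k k * conjState ρ U l l ∂μ
        = ∫ U, ∑ l, conjState ρ U k k * conjState ρ U l l ∂μ := fun k =>
      (integral_finsetSum _ fun l _ => I k k l l).symm
    simp only [this]
    rw [← integral_finsetSum _ fun k _ => integrable_finsetSum _ fun l _ => I k k l l]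
    simp only [← Finset.mul_sum, conjState_trace ρ hρ1, mul_one]
    simp
  have hd : (d : ℂ) ≠ 0 := by
    have := i.pos
    exact_mod_cast this.ne'
  have hd1 : (d : ℂ) + 1 ≠ 0 := by exact_mod_cast Nat.succ_ne_zero d
  simp only [hG, ← Finset.mul_sum, Finset.sum_add_distrib] at hsum
  simp at hsum
  rw [hG]
  have : a / 2 = 1 / ((d : ℂ) * (d + 1)) := by
    field_simp
    linear_combination 2 * hsum
  rw [this]; ring

lemma haar_second (hρ : ρ.PosSemidef)
    (hρ1 : ρ.trace = 1) (hρ2 : ρ * ρ = ρ) (O : Matrix (Fin d) (Fin d) ℂ) (hO : O.IsHermitian) :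
    ∫ U, ((O * conjState ρ U).trace) ^ 2 ∂μ
      = ((O.trace) ^ 2 + (O * O).trace) / ((d : ℂ) * (d + 1)) := by
  have I := integrable_prod μ ρ
  let W : Matrix (Fin d) (Fin d) ℂ := hO.eigenvectorUnitary.1
  have hW : star W * W = 1 := Matrix.mem_unitaryGroup_iff'.1 hO.eigenvectorUnitary.2
  let v : Fin d → ℂ := RCLike.ofReal ∘ hO.eigenvalues
  have hOW : O = W * Matrix.diagonal v * star W := by
    have := hO.spectral_theorem
    rwa [Unitary.conjStarAlgAut_apply] at this
  have ht : O.trace = ∑ i, v i := by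
    rw [hOW, Matrix.trace_mul_comm, ← Matrix.mul_assoc, hW, Matrix.one_mul, Matrix.trace_diagonal]
  have ht2 : (O * O).trace = ∑ i, v i * v i := by
    have : O * O = W * Matrix.diagonal (fun i => v i * v i) * star W := by
      rw [← Matrix.diagonal_mul_diagonal]
      calc O * O = W * (Matrix.diagonal v * (star W * W) * Matrix.diagonal v) * star W := by
            rw [hOW]; simp only [Matrix.mul_assoc]
        _ = _ := by rw [hW, Matrix.mul_one]
    rw [this, Matrix.trace_mul_comm, ← Matrix.mul_assoc, hW, Matrix.one_mul, Matrix.trace_diagonal]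
  have h := invariance μ ρ (star W) (by rw [star_star]; exact hW)
    (fun R => (∑ i, v i * R i i) ^ 2)
  have e : ∀ R : Matrix (Fin d) (Fin d) ℂ,
      (O * R).trace = ∑ i, v i * (star W * R * star (star W)) i i := by
    intro R
    rw [star_star]
    calc (O * R).trace = (W * (Matrix.diagonal v * star W * R)).trace := by
          rw [hOW]; simp only [Matrix.mul_assoc]
      _ = (Matrix.diagonal v * (star W * R * W)).trace := by
          rw [Matrix.trace_mul_comm]; simp only [Matrix.mul_assoc]
      _ = _ := by
          simp only [Matrix.trace, Matrix.diag, Matrix.diagonal_mul]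
  rw [ht, ht2]
  simp only [e]
  rw [h]
  have e2 : ∀ U, (∑ i, v i * conjState ρ U i i) ^ 2
      = ∑ i, ∑ j, (v i * v j) * (conjState ρ U i i * conjState ρ U j j) := by
    intro U
    rw [sq, Finset.sum_mul_sum]
    refine Finset.sum_congr rfl fun i _ => Finset.sum_congr rfl fun j _ => by ring
  simp only [e2]
  rw [integral_finsetSum _ fun i _ => integrable_finsetSum _ fun j _ => (I i i j j).const_mul _]
  have e3 : ∀ i, ∫ U, ∑ j, (v i * v j) * (conjState ρ U i i * conjState ρ U j j) ∂μ
      = ∑ j, (v i * v j) * ((1 + if i = j then 1 else 0) / ((d : ℂ) * (d + 1))) := by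
    intro i
    rw [integral_finsetSum _ fun j _ => (I i i j j).const_mul _]
    refine Finset.sum_congr rfl fun j _ => ?_
    rw [integral_const_mul, moment_value μ ρ hρ hρ1 hρ2]
  simp only [e3, ← mul_div_assoc, ← Finset.sum_div, mul_add, Finset.sum_add_distrib, mul_one]
  rw [sq, Finset.sum_mul_sum]
  simp

end moments

/-- Second moment of the cost under `ν` via the second-order expressivity operator:
`E_ν[C²] = ((Tr[O])² + Tr[O²])/(d² − 1)·(1 − 1/d) − Tr[(O ⊗ O)·A₂(ρ⊗ρ)]`. -/
theorem second_moment_cost_expressivity (d : ℕ) (hd : 2 ≤ d)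
    (μ ν : Measure (Matrix.unitaryGroup (Fin d) ℂ))
    [μ.IsHaarMeasure] [IsProbabilityMeasure μ] [IsProbabilityMeasure ν]
    (O : Matrix (Fin d) (Fin d) ℂ) (hO : O.IsHermitian)
    (ρ : Matrix (Fin d) (Fin d) ℂ) (hρ : ρ.PosSemidef)
    (hρ1 : ρ.trace = 1) (hρ2 : ρ * ρ = ρ)
    (A₂ : Matrix (Fin d × Fin d) (Fin d × Fin d) ℂ)
    (hA₂ : A₂ = (∫ V : Matrix.unitaryGroup (Fin d) ℂ,
                    (V.1 ⊗ₖ V.1) * (ρ ⊗ₖ ρ) * star (V.1 ⊗ₖ V.1) ∂μ)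
              - ∫ U : Matrix.unitaryGroup (Fin d) ℂ,
                    (U.1 ⊗ₖ U.1) * (ρ ⊗ₖ ρ) * star (U.1 ⊗ₖ U.1) ∂ν) :
    ∫ U : Matrix.unitaryGroup (Fin d) ℂ, ((O * (U.1 * ρ * star U.1)).trace) ^ 2 ∂ν
      = ((O.trace) ^ 2 + (O * O).trace) / ((d : ℂ) ^ 2 - 1) * (1 - 1 / (d : ℂ))
        - ((O ⊗ₖ O) * A₂).trace := by
  have hμ := trace_part μ O ρ
  have hν := trace_part ν O ρ
  have hH := haar_second μ ρ hρ hρ1 hρ2 O hO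
  have hd0 : (d : ℂ) ≠ 0 := by exact_mod_cast (by omega : d ≠ 0)
  have hd1 : (d : ℂ) + 1 ≠ 0 := by exact_mod_cast Nat.succ_ne_zero d
  have hd2 : (d : ℂ) - 1 ≠ 0 := by
    rw [sub_ne_zero]
    exact_mod_cast (by omega : d ≠ 1)
  simp only [conjState] at hH
  rw [hA₂, Matrix.mul_sub, Matrix.trace_sub, hμ, hν, hH]
  have : (d : ℂ) ^ 2 - 1 = (d - 1) * (d + 1) := by ring
  rw [this]
  field_simp
  ring
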